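/- Let X = (Ω, ℱ, ℙ, τ) be a metric dynamical system and let V, V' be potentials with V ≥ v_min > 0 and ‖V' − V‖_∞ < v_min. Then for every y ∈ ℝ^d, |Γ_V(y)² − Γ_{V'}(y)²| ≤ ‖V' − V‖_∞ · Γ_V(y)² / v_min. -/

import Mathlib

open MeasureTheory Filter

noncomputable section

/-- `ℝ^d` with the Euclidean norm. -/
abbrev Rd (d : ℕ) := EuclideanSpace ℝ (Fin d)

variable {d : ℕ} {Ω : Type*} [MeasurableSpace Ω]

/-- The realisation `f_ω : ℝ^d → E`, `f_ω(x) = f(τ_x ω)`. -/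
def realise (τ : Rd d → Ω → Ω) {E : Type*} (f : Ω → E) (ω : Ω) : Rd d → E :=
  fun x => f (τ x ω)

/-- `(Ω, ℱ, ℙ, τ)` is a metric dynamical system: `ℙ` is a probability measure, `τ` is a
jointly measurable action of `(ℝ^d, +)` on `Ω` leaving `ℙ` invariant. -/
def IsMDS (P : Measure Ω) (τ : Rd d → Ω → Ω) : Prop :=
  IsProbabilityMeasure P ∧ Measurable (Function.uncurry τ) ∧
    (∀ x y ω, τ (x + y) ω = τ x (τ y ω)) ∧ (∀ ω, τ 0 ω = ω) ∧
    ∀ x, MeasurePreserving (τ x) P P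

/-- A potential: a nonnegative function in `L¹(ℙ)`. -/
def IsPotential (P : Measure Ω) (V : Ω → ℝ) : Prop :=
  Measurable V ∧ (∀ ω, 0 ≤ V ω) ∧ Integrable V P

/-- The space `𝔽`: probability densities `f ∈ L¹(ℙ)` with `𝔼f = 1`, bounded away from `0`,
all realisations smooth, and `sup_Ω |Dⁿf| < ∞` for all `n`. -/
def memF (P : Measure Ω) (τ : Rd d → Ω → Ω) (f : Ω → ℝ) : Prop :=
  Measurable f ∧ Integrable f P ∧ (∫ ω, f ω ∂P) = 1 ∧ (∃ c > 0, ∀ ω, c ≤ f ω) ∧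
    (∀ ω, ContDiff ℝ (⊤ : ℕ∞) (realise τ f ω)) ∧
    (∀ n : ℕ, ∃ C, ∀ ω, ‖iteratedFDeriv ℝ n (realise τ f ω) 0‖ ≤ C)

/-- The space `Φ_y`: vector fields `φ ∈ (L¹(ℙ))^d` with smooth realisations, all derivatives
uniformly bounded, `𝔼φ = y`, and divergence-free realisations. -/
def memPhi (P : Measure Ω) (τ : Rd d → Ω → Ω) (y : Rd d) (φ : Ω → Rd d) : Prop :=
  Measurable φ ∧ Integrable φ P ∧ (∫ ω, φ ω ∂P) = y ∧
    (∀ ω, ContDiff ℝ (⊤ : ℕ∞) (realise τ φ ω)) ∧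
    (∀ n : ℕ, ∃ C, ∀ ω, ‖iteratedFDeriv ℝ n (realise τ φ ω) 0‖ ≤ C) ∧
    (∀ ω x, (∑ i, fderiv ℝ (fun z => realise τ φ ω z i) x (EuclideanSpace.single i 1)) = 0)

/-- The energy term `∫ (|∇f|²/(8f) + Vf) dℙ`. -/
def energy (P : Measure Ω) (τ : Rd d → Ω → Ω) (V f : Ω → ℝ) : ℝ :=
  ∫ ω, (‖fderiv ℝ (realise τ f ω) 0‖ ^ 2 / (8 * f ω) + V ω * f ω) ∂P

/-- The transport term `inf_{φ ∈ Φ_y} ∫ |φ|²/(2f) dℙ`. -/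
def transport (P : Measure Ω) (τ : Rd d → Ω → Ω) (f : Ω → ℝ) (y : Rd d) : ℝ :=
  sInf {r | ∃ φ, memPhi P τ y φ ∧ r = ∫ ω, ‖φ ω‖ ^ 2 / (2 * f ω) ∂P}

/-- The variational functional
`Γ_V(y) = 2 inf_{f ∈ 𝔽} [ (∫ |∇f|²/(8f) + Vf dℙ) (inf_{φ ∈ Φ_y} ∫ |φ|²/(2f) dℙ) ]^{1/2}`. -/
def Gamma (P : Measure Ω) (τ : Rd d → Ω → Ω) (V : Ω → ℝ) (y : Rd d) : ℝ :=
  2 * sInf {r | ∃ f, memF P τ f ∧ r = Real.sqrt (energy P τ V f * transport P τ f y)}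

end

theorem aux_transport_nonneg {d : ℕ} {Ω : Type*} [MeasurableSpace Ω]
    (P : Measure Ω) (τ : Rd d → Ω → Ω) (f : Ω → ℝ) (hf : memF P τ f) (y : Rd d) :
    0 ≤ transport P τ f y := by
  obtain ⟨-, -, -, ⟨c, hc, hcf⟩, -, -⟩ := hf
  apply Real.sInf_nonneg
  rintro r ⟨φ, -, rfl⟩
  apply integral_nonneg
  intro ω
  have : 0 < f ω := lt_of_lt_of_le hc (hcf ω)
  show 0 ≤ ‖φ ω‖ ^ 2 / (2 * f ω)
  positivity

theorem aux_gamma_nonneg {d : ℕ} {Ω : Type*} [MeasurableSpace Ω]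
    (P : Measure Ω) (τ : Rd d → Ω → Ω) (V : Ω → ℝ) (y : Rd d) :
    0 ≤ Gamma P τ V y := by
  unfold Gamma
  apply mul_nonneg (by norm_num)
  apply Real.sInf_nonneg
  rintro r ⟨f, -, rfl⟩
  exact Real.sqrt_nonneg _

theorem aux_gamma_le {d : ℕ} {Ω : Type*} [MeasurableSpace Ω]
    (P : Measure Ω) (τ : Rd d → Ω → Ω) (V V' : Ω → ℝ) (y : Rd d) (c : ℝ) (hc : 0 < c)
    (h : ∀ f, memF P τ f → energy P τ V' f ≤ c * energy P τ V f) :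
    (Gamma P τ V' y) ^ 2 ≤ c * (Gamma P τ V y) ^ 2 := by
  have hs : 0 < Real.sqrt c := Real.sqrt_pos.2 hc
  have key : Gamma P τ V' y ≤ Real.sqrt c * Gamma P τ V y := by
    unfold Gamma
    rw [mul_left_comm]
    apply mul_le_mul_of_nonneg_left _ (by norm_num)
    by_cases hne : ∃ f, memF P τ f
    · obtain ⟨f0, hf0⟩ := hne
      rw [← div_le_iff₀' hs]
      refine le_csInf (show Set.Nonempty _ from ⟨Real.sqrt (energy P τ V f0 * transport P τ f0 y), f0, hf0, rfl⟩) ?_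
      rintro r ⟨f, hf, rfl⟩
      rw [div_le_iff₀' hs, ← Real.sqrt_mul hc.le]
      refine le_trans (csInf_le ?_ ⟨f, hf, rfl⟩) ?_
      · refine ⟨0, ?_⟩
        rintro r ⟨f, -, rfl⟩
        exact Real.sqrt_nonneg _
      · apply Real.sqrt_le_sqrt
        rw [← mul_assoc]
        exact mul_le_mul_of_nonneg_right (h f hf) (aux_transport_nonneg P τ f hf y)
    · have e : ∀ W : Ω → ℝ, {r | ∃ f, memF P τ f ∧
          r = Real.sqrt (energy P τ W f * transport P τ f y)} = ∅ := by
        intro W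
        ext r
        simp only [Set.mem_ofPred_eq, Set.mem_empty_iff_false, iff_false]
        rintro ⟨f, hf, -⟩
        exact hne ⟨f, hf⟩
      rw [e, e]
      simp
  calc (Gamma P τ V' y) ^ 2 ≤ (Real.sqrt c * Gamma P τ V y) ^ 2 :=
        pow_le_pow_left₀ (aux_gamma_nonneg P τ V' y) key 2
    _ = c * (Gamma P τ V y) ^ 2 := by rw [mul_pow, Real.sq_sqrt hc.le]

theorem aux_energy {d : ℕ} {Ω : Type*} [MeasurableSpace Ω]
    (P : Measure Ω) (τ : Rd d → Ω → Ω) (hX : IsMDS P τ)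
    (V V' : Ω → ℝ) (hV : IsPotential P V) (hV' : IsPotential P V')
    (vmin : ℝ) (hvmin : 0 < vmin) (hge : ∀ ω, vmin ≤ V ω)
    (δ : ℝ) (hδ0 : 0 ≤ δ) (hδ : ∀ᵐ ω ∂P, |V' ω - V ω| ≤ δ) (f : Ω → ℝ) (hf : memF P τ f) :
    |energy P τ V' f - energy P τ V f| ≤ δ / vmin * energy P τ V f := by
  obtain ⟨hfm, hfi, hf1, ⟨c, hc, hcf⟩, -, hfb⟩ := hf
  obtain ⟨-, -, -, h0, -⟩ := hX
  obtain ⟨C, hC⟩ := hfb 0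
  have hb : ∀ ω, ‖f ω‖ ≤ C := by
    intro ω
    have := hC ω
    rwa [norm_iteratedFDeriv_zero, realise, h0] at this
  have hpos : ∀ ω, 0 < f ω := fun ω => lt_of_lt_of_le hc (hcf ω)
  have hVf : Integrable (fun ω => V ω * f ω) P :=
    hV.2.2.mul_bdd (c := C) hfm.aestronglyMeasurable (Eventually.of_forall hb)
  have hVf' : Integrable (fun ω => V' ω * f ω) P :=
    hV'.2.2.mul_bdd (c := C) hfm.aestronglyMeasurable (Eventually.of_forall hb)
  unfold energy
  set G : Ω → ℝ := fun ω => ‖fderiv ℝ (realise τ f ω) 0‖ ^ 2 / (8 * f ω) with hG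
  have hGn : ∀ ω, 0 ≤ G ω := by
    intro ω
    have := hpos ω
    simp only [hG]
    positivity
  change |∫ ω, (G ω + V' ω * f ω) ∂P - ∫ ω, (G ω + V ω * f ω) ∂P|
    ≤ δ / vmin * ∫ ω, (G ω + V ω * f ω) ∂P
  by_cases hGi : Integrable G P
  · have hE : vmin ≤ ∫ ω, (G ω + V ω * f ω) ∂P := by
      calc vmin = ∫ ω, vmin * f ω ∂P := by rw [integral_const_mul, hf1, mul_one]
        _ ≤ _ := by
          apply integral_mono (hfi.const_mul _) (hGi.add hVf)
          intro ω
          have h1 := mul_le_mul_of_nonneg_right (hge ω) (hpos ω).le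
          have h2 := hGn ω
          show vmin * f ω ≤ G ω + V ω * f ω
          linarith
    have hD : |∫ ω, (G ω + V' ω * f ω) ∂P - ∫ ω, (G ω + V ω * f ω) ∂P| ≤ δ := by
      have i1 : Integrable (fun ω => G ω + V ω * f ω) P := hGi.add hVf
      have i2 : Integrable (fun ω => G ω + V' ω * f ω) P := hGi.add hVf'
      rw [← integral_sub i2 i1, ← Real.norm_eq_abs]
      calc _ ≤ ∫ ω, δ * f ω ∂P := by
            apply norm_integral_le_of_norm_le (hfi.const_mul _)
            filter_upwards [hδ] with ω hω
            have e : G ω + V' ω * f ω - (G ω + V ω * f ω) = (V' ω - V ω) * f ω := by ring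
            rw [e, Real.norm_eq_abs, abs_mul, abs_of_pos (hpos ω)]
            exact mul_le_mul_of_nonneg_right hω (hpos ω).le
        _ = δ := by rw [integral_const_mul, hf1, mul_one]
    refine hD.trans ?_
    rw [div_mul_eq_mul_div, le_div_iff₀ hvmin]
    exact mul_le_mul_of_nonneg_left hE hδ0
  · have n1 : ∀ W : Ω → ℝ, Integrable (fun ω => W ω * f ω) P →
        ∫ ω, (G ω + W ω * f ω) ∂P = 0 := by
      intro W hW
      apply integral_undef
      intro hh
      apply hGi
      have := hh.sub hW
      refine this.congr (Eventually.of_forall fun ω => ?_)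
      simp
    rw [n1 V hVf, n1 V' hVf']
    simp

/-- continuity with respect to uniform convergence of the potential:
`|Γ_V² − Γ_{V'}²| ≤ ‖V' − V‖_∞ · Γ_V² / v_min`. -/
theorem gamma_sup_norm_continuity {d : ℕ} {Ω : Type*} [MeasurableSpace Ω]
    (P : Measure Ω) (τ : Rd d → Ω → Ω) (hX : IsMDS P τ)
    (V V' : Ω → ℝ) (hV : IsPotential P V) (hV' : IsPotential P V')
    (vmin : ℝ) (hvmin : 0 < vmin) (hge : ∀ ω, vmin ≤ V ω)
    (hclose : eLpNorm (fun ω => V' ω - V ω) ⊤ P < ENNReal.ofReal vmin) (y : Rd d) :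
    |(Gamma P τ V y) ^ 2 - (Gamma P τ V' y) ^ 2| ≤
      (eLpNorm (fun ω => V' ω - V ω) ⊤ P).toReal * (Gamma P τ V y) ^ 2 / vmin := by
  have hfin : eLpNorm (fun ω => V' ω - V ω) ⊤ P ≠ ⊤ := hclose.ne_top
  have hlt : (eLpNorm (fun ω => V' ω - V ω) ⊤ P).toReal < vmin :=
    (ENNReal.lt_ofReal_iff_toReal_lt hfin).1 hclose
  have hae : ∀ᵐ ω ∂P, |V' ω - V ω| ≤ (eLpNorm (fun ω => V' ω - V ω) ⊤ P).toReal := by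
    rw [eLpNorm_exponent_top] at hfin ⊢
    filter_upwards [ae_le_eLpNormEssSup (f := fun ω => V' ω - V ω) (μ := P)] with ω hω
    have := ENNReal.toReal_mono hfin hω
    simpa using this
  have hδ0 : 0 ≤ (eLpNorm (fun ω => V' ω - V ω) ⊤ P).toReal := ENNReal.toReal_nonneg
  generalize (eLpNorm (fun ω => V' ω - V ω) ⊤ P).toReal = δ at hlt hae hδ0 ⊢
  have hθ0 : 0 ≤ δ / vmin := by positivity
  have hθ1 : δ / vmin < 1 := (div_lt_one hvmin).2 hlt
  have hE := aux_energy P τ hX V V' hV hV' vmin hvmin hge δ hδ0 hae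
  rw [mul_div_right_comm]
  generalize δ / vmin = θ at hθ0 hθ1 hE ⊢
  have h1 := aux_gamma_le P τ V V' y (1 + θ) (by linarith) (fun f hf => by
    have := (abs_le.1 (hE f hf)).2
    linarith)
  have hpos : 0 < 1 - θ := by linarith
  have h2 := aux_gamma_le P τ V' V y (1 - θ)⁻¹ (inv_pos.2 hpos) (fun f hf => by
    have := (abs_le.1 (hE f hf)).1
    rw [← div_eq_inv_mul, le_div_iff₀ hpos]
    linarith)
  rw [← div_eq_inv_mul, le_div_iff₀ hpos] at h2
  rw [abs_le]
  constructor <;> linarith
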